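/- Representation of the fiber H_𝔱: let φ : U → ℝ be a vector-lattice homomorphism with φ(𝔱) = 1. If φ(𝟏) > 0, then there exists t ∈ ℍ such that φ(f) = f(t)/t for all f ∈ U. If φ(𝟏) = 0, then there exists a free ultrafilter 𝒰 on the positive integers such that φ(f) = lim_{𝒰(n)} f(n)/n for all f ∈ U. -/

import Mathlib

open Filter Topology

/-- `Hl` is the half-line `[1, ∞)` with the metric inherited from `ℝ`. -/
abbrev Hl : Type := Set.Ici (1 : ℝ)

/-- `φ` is a vector-lattice homomorphism on the lattice `U` of uniformly continuous
real-valued functions on the half-line: it is additive, homogeneous and preserves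
binary suprema on uniformly continuous functions.  (The value of `φ` outside `U` is
irrelevant: all hypotheses and conclusions only involve uniformly continuous
functions.) -/
def IsLatticeHom (φ : (Hl → ℝ) → ℝ) : Prop :=
  (∀ f g : Hl → ℝ, UniformContinuous f → UniformContinuous g →
      φ (f + g) = φ f + φ g) ∧
  (∀ (c : ℝ) (f : Hl → ℝ), UniformContinuous f → φ (c • f) = c * φ f) ∧
  (∀ f g : Hl → ℝ, UniformContinuous f → UniformContinuous g →
      φ (f ⊔ g) = max (φ f) (φ g))

/-- The point of the half-line corresponding to a positive integer. -/
def toH (n : ℕ+) : Hl := ⟨((n : ℕ) : ℝ), Set.mem_Ici.mpr (by exact_mod_cast n.one_le)⟩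

/-- A uniformly continuous function on the half-line is Lipschitz up to an arbitrarily small
additive error. -/
lemma UniformContinuous.exists_abs_sub_le_mul_add {f : Hl → ℝ} (hf : UniformContinuous f)
    {ε : ℝ} (hε : 0 < ε) :
    ∃ K : ℝ, 0 ≤ K ∧ ∀ x y : Hl, |f x - f y| ≤ K * |(x : ℝ) - y| + ε := by
  obtain ⟨δ, hδ, h⟩ := Metric.uniformContinuous_iff.mp hf ε hε
  have chain : ∀ (n : ℕ) (x y : Hl), |(x : ℝ) - y| < (n + 1) * δ →
      |f x - f y| ≤ (n + 1) * ε := by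
    intro n
    induction n with
    | zero =>
      intro x y hxy
      have := h (a := x) (b := y) (by rw [Subtype.dist_eq, Real.dist_eq]; simpa using hxy)
      rw [Real.dist_eq] at this
      simpa using this.le
    | succ n ih =>
      intro x y hxy
      push_cast at hxy ⊢
      have hn : (0 : ℝ) < n + 1 + 1 := by positivity
      let s : ℝ := 1 / (n + 1 + 1)
      have hs : s * (n + 1 + 1) = 1 := by simp only [s]; field_simp
      have hs0 : 0 < s := by positivity
      have hs1 : s ≤ 1 := by
        have : (0 : ℝ) ≤ n := n.cast_nonneg
        nlinarith
      let z : Hl := ⟨(1 - s) * x + s * y,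
        (convex_Ici (1 : ℝ)) x.2 y.2 (by linarith) hs0.le (by ring)⟩
      have hxz : |(x : ℝ) - z| < δ := by
        have : (x : ℝ) - z = s * (x - y) := by simp only [z]; ring
        rw [this, abs_mul, abs_of_pos hs0]
        calc s * |(x : ℝ) - y| < s * ((n + 1 + 1) * δ) := by gcongr
          _ = δ := by rw [← mul_assoc, hs, one_mul]
      have hzy : |(z : ℝ) - y| < (n + 1) * δ := by
        have : (z : ℝ) - y = (1 - s) * (x - y) := by simp only [z]; ring
        have hs' : 1 - s = s * (n + 1) := by linarith
        rw [this, abs_mul, hs', abs_of_nonneg (by positivity)]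
        calc s * (n + 1) * |(x : ℝ) - y| < s * (n + 1) * ((n + 1 + 1) * δ) := by gcongr
          _ = (s * (n + 1 + 1)) * ((n + 1) * δ) := by ring
          _ = (n + 1) * δ := by rw [hs, one_mul]
      have h₁ := h (a := x) (b := z) (by rwa [Subtype.dist_eq, Real.dist_eq])
      rw [Real.dist_eq] at h₁
      linarith [ih z y hzy, abs_sub_le (f x) (f z) (f y)]
  refine ⟨ε / δ, by positivity, fun x y => ?_⟩
  have hlt : |(x : ℝ) - y| < (⌊|(x : ℝ) - y| / δ⌋₊ + 1) * δ :=
    (div_lt_iff₀ hδ).mp (Nat.lt_floor_add_one _)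
  have hfl : (⌊|(x : ℝ) - y| / δ⌋₊ : ℝ) ≤ |(x : ℝ) - y| / δ := Nat.floor_le (by positivity)
  calc |f x - f y| ≤ (⌊|(x : ℝ) - y| / δ⌋₊ + 1) * ε := chain _ x y hlt
    _ ≤ (|(x : ℝ) - y| / δ + 1) * ε := by gcongr
    _ = ε / δ * |(x : ℝ) - y| + ε := by ring

lemma uniformContinuous_coe_Hl : UniformContinuous (fun t : Hl => (t : ℝ)) :=
  uniformContinuous_subtype_val

namespace IsLatticeHom

variable {φ : (Hl → ℝ) → ℝ} {f g : Hl → ℝ}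

lemma map_add (hφ : IsLatticeHom φ) (hf : UniformContinuous f) (hg : UniformContinuous g) :
    φ (fun t => f t + g t) = φ f + φ g :=
  hφ.1 f g hf hg

lemma map_const_mul (hφ : IsLatticeHom φ) (c : ℝ) (hf : UniformContinuous f) :
    φ (fun t => c * f t) = c * φ f :=
  hφ.2.1 c f hf

lemma map_const (hφ : IsLatticeHom φ) (c : ℝ) :
    φ (fun _ => c) = c * φ (fun _ => (1 : ℝ)) := by
  simpa using hφ.map_const_mul c (uniformContinuous_const (b := (1 : ℝ)))

lemma map_sub (hφ : IsLatticeHom φ) (hf : UniformContinuous f) (hg : UniformContinuous g) :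
    φ (fun t => f t - g t) = φ f - φ g := by
  have h := hφ.map_add (hf.sub hg) hg
  simp only [sub_add_cancel] at h
  exact eq_sub_of_add_eq h.symm

lemma mono (hφ : IsLatticeHom φ) (hf : UniformContinuous f) (hg : UniformContinuous g)
    (h : ∀ t, f t ≤ g t) : φ f ≤ φ g := by
  have hsup := hφ.2.2 f g hf hg
  rw [sup_eq_right.mpr (show f ≤ g from h)] at hsup
  exact hsup ▸ le_max_left _ _

lemma map_abs (hφ : IsLatticeHom φ) (hf : UniformContinuous f) :
    φ (fun t => |f t|) = |φ f| := by
  have hneg : φ (-f) = -φ f := by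
    simpa using hφ.2.1 (-1) f hf
  have h := hφ.2.2 f (-f) hf hf.neg
  rw [hneg] at h
  exact h

/-- A homomorphism normalized at the identity and not vanishing at `1` is a multiple of the
evaluation at the point `1 / φ 1`. -/
lemma exists_eq_div (hφ : IsLatticeHom φ) (ht : φ (fun t : Hl => (t : ℝ)) = 1)
    (h1 : 0 < φ (fun _ => (1 : ℝ))) :
    ∃ t : Hl, ∀ f : Hl → ℝ, UniformContinuous f → φ f = f t / (t : ℝ) := by
  set c := φ (fun _ => (1 : ℝ)) with hc
  have hc1 : c ≤ 1 := ht ▸ hφ.mono uniformContinuous_const uniformContinuous_coe_Hl fun t => t.2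
  let t₀ : Hl := ⟨1 / c, (one_le_div h1).mpr hc1⟩
  have hct : (t₀ : ℝ) * c = 1 := one_div_mul_cancel h1.ne'
  refine ⟨t₀, fun f hf => ?_⟩
  have hdist : φ (fun t => |(t : ℝ) - t₀|) = 0 := by
    rw [hφ.map_abs (uniformContinuous_coe_Hl.sub uniformContinuous_const),
      hφ.map_sub uniformContinuous_coe_Hl uniformContinuous_const, hφ.map_const, ← hc, ht, hct,
      sub_self, abs_zero]
  have hdist_uc : UniformContinuous (fun t : Hl => |(t : ℝ) - t₀|) :=
    uniformContinuous_norm.comp (uniformContinuous_coe_Hl.sub uniformContinuous_const)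
  have hle : |φ f - f t₀ * c| ≤ 0 := by
    refine le_of_forall_pos_le_add fun ε hε => ?_
    obtain ⟨K, -, hK⟩ := hf.exists_abs_sub_le_mul_add hε
    have hfs : UniformContinuous (fun t => f t - f t₀) := hf.sub uniformContinuous_const
    have hKd : UniformContinuous (fun t : Hl => K * |(t : ℝ) - t₀|) := hdist_uc.const_mul' K
    have h := hφ.mono (uniformContinuous_norm.comp hfs) (hKd.add (uniformContinuous_const (b := ε)))
      fun t => hK t t₀
    have e₁ : φ (fun t => ‖f t - f t₀‖) = |φ f - f t₀ * c| := by
      rw [← hφ.map_const, ← hφ.map_sub hf uniformContinuous_const]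
      exact hφ.map_abs hfs
    have e₂ : φ (fun t => K * |(t : ℝ) - t₀| + ε) = ε * c := by
      rw [hφ.map_add hKd uniformContinuous_const, hφ.map_const_mul K hdist_uc, hdist,
        hφ.map_const, mul_zero, zero_add]
    have h' : |φ f - f t₀ * c| ≤ ε * c := by
      rw [← e₁, ← e₂]
      exact h
    nlinarith
  have heq : φ f = f t₀ * c := sub_eq_zero.mp (abs_nonpos_iff.mp hle)
  have ht₀ : (t₀ : ℝ) ≠ 0 := left_ne_zero_of_mul_eq_one hct
  rw [heq, eq_div_iff ht₀, mul_assoc, mul_comm c, hct, mul_one]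

/-- When `φ` vanishes at `1`, no function in the kernel of `φ` dominates the identity on the
positive integers. -/
lemma exists_lt_of_map_eq_zero (hφ : IsLatticeHom φ) (ht : φ (fun t : Hl => (t : ℝ)) = 1)
    (h1 : φ (fun _ => (1 : ℝ)) = 0) (hg : UniformContinuous g) (hg0 : φ g = 0) :
    ∃ n : ℕ+, g (toH n) < n := by
  by_contra! hge
  obtain ⟨K, hK0, hK⟩ := hg.exists_abs_sub_le_mul_add one_pos
  have hbound : ∀ t : Hl, (t : ℝ) ≤ g t + (K + 2) := by
    intro t
    have ht1 : (1 : ℝ) ≤ t := t.2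
    let n : ℕ+ := ⟨⌊(t : ℝ)⌋₊, Nat.floor_pos.mpr ht1⟩
    have hn : ((n : ℕ) : ℝ) ≤ t := Nat.floor_le (by linarith)
    have hn' : (t : ℝ) < (n : ℕ) + 1 := Nat.lt_floor_add_one _
    have hd : |((toH n : Hl) : ℝ) - t| ≤ 1 := by
      change |((n : ℕ) : ℝ) - t| ≤ 1
      rw [abs_le]
      constructor <;> linarith
    have := mul_le_mul_of_nonneg_left hd hK0
    linarith [hge n, hK (toH n) t, le_abs_self (g (toH n) - g t)]
  have h := hφ.mono uniformContinuous_coe_Hl (hg.add (uniformContinuous_const (b := K + 2)))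
    hbound
  have e : φ (fun t => g t + (K + 2)) = 0 := by
    rw [hφ.map_add hg uniformContinuous_const, hg0, hφ.map_const, h1, mul_zero, add_zero]
  rw [ht] at h
  exact absurd (h.trans_eq e) (by norm_num)

/-- When `φ` vanishes at `1`, it is a limit of the normalized evaluations `f ↦ f(n)/n` along a
free ultrafilter. -/
lemma exists_ultrafilter_tendsto (hφ : IsLatticeHom φ) (ht : φ (fun t : Hl => (t : ℝ)) = 1)
    (h1 : φ (fun _ => (1 : ℝ)) = 0) :
    ∃ 𝒰 : Ultrafilter ℕ+, (∀ n : ℕ+, 𝒰 ≠ pure n) ∧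
      ∀ f : Hl → ℝ, UniformContinuous f →
        Tendsto (fun n : ℕ+ => f (toH n) / ((n : ℕ) : ℝ)) ↑𝒰 (𝓝 (φ f)) := by
  let I := {g : Hl → ℝ // UniformContinuous g ∧ (∀ t, 0 ≤ g t) ∧ φ g = 0}
  let S : I → Set ℕ+ := fun g => {n | g.1 (toH n) < (n : ℕ)}
  have : Nonempty I := ⟨⟨fun _ => 1, uniformContinuous_const, fun _ => zero_le_one, h1⟩⟩
  have hdir : Directed (· ≥ ·) fun g : I => 𝓟 (S g) := by
    rintro ⟨g₁, hu₁, hp₁, hz₁⟩ ⟨g₂, hu₂, hp₂, hz₂⟩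
    refine ⟨⟨fun t => g₁ t + g₂ t, hu₁.add hu₂, fun t => add_nonneg (hp₁ t) (hp₂ t), ?_⟩, ?_, ?_⟩
    · rw [hφ.map_add hu₁ hu₂, hz₁, hz₂, add_zero]
    · exact principal_mono.mpr fun n (hn : g₁ (toH n) + g₂ (toH n) < (n : ℕ)) =>
        show g₁ (toH n) < (n : ℕ) by linarith [hp₂ (toH n)]
    · exact principal_mono.mpr fun n (hn : g₁ (toH n) + g₂ (toH n) < (n : ℕ)) =>
        show g₂ (toH n) < (n : ℕ) by linarith [hp₁ (toH n)]
  have : NeBot (⨅ g : I, 𝓟 (S g)) := iInf_neBot_of_directed' hdir fun g =>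
    principal_neBot_iff.mpr (hφ.exists_lt_of_map_eq_zero ht h1 g.2.1 g.2.2.2)
  let 𝒰 := Ultrafilter.of (⨅ g : I, 𝓟 (S g))
  have hS : ∀ g : I, S g ∈ 𝒰 := fun g =>
    Ultrafilter.of_le _ (mem_iInf_of_mem g (mem_principal_self _))
  refine ⟨𝒰, fun n hn => ?_, fun f hf => ?_⟩
  · have h := hS ⟨fun _ => (n : ℕ), uniformContinuous_const, fun _ => Nat.cast_nonneg _, by
      rw [hφ.map_const, h1, mul_zero]⟩
    rw [hn, Ultrafilter.mem_pure] at h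
    exact lt_irrefl ((n : ℕ) : ℝ) h
  · refine Metric.tendsto_nhds.mpr fun ε hε => ?_
    have hlin : UniformContinuous (fun t : Hl => φ f * (t : ℝ)) :=
      uniformContinuous_coe_Hl.const_mul' _
    have hsub : UniformContinuous (fun t : Hl => f t - φ f * (t : ℝ)) := hf.sub hlin
    have habs : UniformContinuous (fun t : Hl => |f t - φ f * (t : ℝ)|) :=
      uniformContinuous_norm.comp hsub
    have hzero : φ (fun t : Hl => ε⁻¹ * |f t - φ f * (t : ℝ)|) = 0 := by
      rw [hφ.map_const_mul _ habs, hφ.map_abs hsub, hφ.map_sub hf hlin,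
        hφ.map_const_mul _ uniformContinuous_coe_Hl, ht, mul_one, sub_self, abs_zero, mul_zero]
    filter_upwards [hS ⟨_, habs.const_mul' ε⁻¹, fun t => by positivity, hzero⟩] with n hn
    have hn' : ε⁻¹ * |f (toH n) - φ f * ((n : ℕ) : ℝ)| < (n : ℕ) := hn
    have hn0 : (0 : ℝ) < (n : ℕ) := by exact_mod_cast n.pos
    rw [inv_mul_lt_iff₀ hε] at hn'
    rwa [Real.dist_eq, div_sub' hn0.ne', abs_div, abs_of_pos hn0, div_lt_iff₀ hn0,
      mul_comm ((n : ℕ) : ℝ)]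

end IsLatticeHom

/-- Representation of the fiber `H_𝔱`: a vector-lattice homomorphism `φ : U → ℝ` with
`φ(𝔱) = 1` is either a normalized evaluation `f ↦ f(t)/t` (when `φ(𝟏) > 0`) or of the
form `f ↦ lim_{𝒰(n)} f(n)/n` for some free ultrafilter `𝒰` on the positive integers
(when `φ(𝟏) = 0`). -/
theorem fiber_representation (φ : (Hl → ℝ) → ℝ) (hφ : IsLatticeHom φ)
    (ht : φ (fun t : Hl => (t : ℝ)) = 1) :
    (0 < φ (fun _ => (1 : ℝ)) →
      ∃ t : Hl, ∀ f : Hl → ℝ, UniformContinuous f → φ f = f t / (t : ℝ)) ∧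
    (φ (fun _ => (1 : ℝ)) = 0 →
      ∃ 𝒰 : Ultrafilter ℕ+, (∀ n : ℕ+, 𝒰 ≠ pure n) ∧
        ∀ f : Hl → ℝ, UniformContinuous f →
          Tendsto (fun n : ℕ+ => f (toH n) / ((n : ℕ) : ℝ)) ↑𝒰 (𝓝 (φ f))) := by
  exact ⟨hφ.exists_eq_div ht, hφ.exists_ultrafilter_tendsto ht⟩
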